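/- Suppose Ω ⊂ ℝⁿ is a quasihyperbolically well behaved bounded domain and Ω' ⊂ ℝⁿ is a bounded QH-visibility domain. Then every continuous (1, μ)-quasi-isometric embedding f : (Ω, k_Ω) → (Ω', k_{Ω'}) (i.e., a continuous map with k_Ω(x,y) − μ ≤ k_{Ω'}(f(x), f(y)) ≤ k_Ω(x,y) + μ for all x, y ∈ Ω) extends to a continuous map F : Ω̄^Euc → Ω̄'^Euc between the Euclidean closures. -/

import Mathlib

open Metric Set Filter Topology MeasureTheory
open scoped NNReal ENNReal

noncomputable section

variable {E : Type*} [NormedAddCommGroup E] [NormedSpace ℝ E]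

/-- The quasihyperbolic length of a path `γ : [a, b] → Ω`, i.e. `∫ ‖γ'(t)‖ / δ_Ω(γ t) dt`. -/
def qhLength (Ω : Set E) (γ : ℝ → E) (a b : ℝ) : ℝ :=
  ∫ t in a..b, ‖deriv γ t‖ / infDist (γ t) Ωᶜ

/-- Admissible (Lipschitz, i.e. rectifiable) paths joining `x` to `y` inside `Ω`. -/
def qhAdmissible (Ω : Set E) (x y : E) (γ : ℝ → E) (a b : ℝ) : Prop :=
  a ≤ b ∧ γ a = x ∧ γ b = y ∧ (∀ t ∈ Icc a b, γ t ∈ Ω) ∧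
    ∃ K : ℝ≥0, LipschitzOnWith K γ (Icc a b)

/-- The quasihyperbolic distance `k_Ω` on a domain `Ω`. -/
def qhDist (Ω : Set E) (x y : E) : ℝ :=
  sInf { L : ℝ | ∃ γ a b, qhAdmissible Ω x y γ a b ∧ L = qhLength Ω γ a b }

/-- `γ` is a (unit-speed) quasihyperbolic geodesic on the parameter set `s`. -/
def IsQHGeodesicOn (Ω : Set E) (γ : ℝ → E) (s : Set ℝ) : Prop :=
  (∀ t ∈ s, γ t ∈ Ω) ∧ ∀ a ∈ s, ∀ b ∈ s, qhDist Ω (γ a) (γ b) = |a - b|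

/-- `Ω` is a QH-visibility domain: any two distinct Euclidean boundary points have
neighbourhoods with disjoint closures together with a compact subset of `Ω` which is met by
every quasihyperbolic geodesic joining the two neighbourhoods. -/
def QHVisibilityDomain (Ω : Set E) : Prop :=
  ∀ p ∈ frontier Ω, ∀ q ∈ frontier Ω, p ≠ q →
    ∃ U V : Set E, IsOpen U ∧ IsOpen V ∧ p ∈ U ∧ q ∈ V ∧
      closure U ∩ closure V = ∅ ∧
      ∃ K : Set E, IsCompact K ∧ K ⊆ Ω ∧
        ∀ (γ : ℝ → E) (T : ℝ), 0 ≤ T → IsQHGeodesicOn Ω γ (Icc 0 T) →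
          γ 0 ∈ U → γ T ∈ V → ∃ t ∈ Icc 0 T, γ t ∈ K

/-- The quasihyperbolic distance from a point to a set. -/
def qhDistToSet (Ω : Set E) (x : E) (S : Set E) : ℝ :=
  sInf (qhDist Ω x '' S)

/-- `Ω` is quasihyperbolically well behaved: whenever two sequences in `Ω` converge to the
same Euclidean boundary point, the quasihyperbolic distance from any fixed point of `Ω` to
any quasihyperbolic geodesics joining them tends to infinity. -/
def QHWellBehaved (Ω : Set E) : Prop :=
  ∀ p ∈ frontier Ω, ∀ (x y : ℕ → E) (γ : ℕ → ℝ → E) (a b : ℕ → ℝ),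
    (∀ k, x k ∈ Ω) → (∀ k, y k ∈ Ω) →
    Tendsto x atTop (𝓝 p) → Tendsto y atTop (𝓝 p) →
    (∀ k, a k ≤ b k) → (∀ k, IsQHGeodesicOn Ω (γ k) (Icc (a k) (b k))) →
    (∀ k, γ k (a k) = x k) → (∀ k, γ k (b k) = y k) →
    ∀ x₀ ∈ Ω, Tendsto (fun k => qhDistToSet Ω x₀ (γ k '' Icc (a k) (b k))) atTop atTop

section QuasihyperbolicMetric

set_option linter.unusedSectionVars false

variable [FiniteDimensional ℝ E] {Ω : Set E} {x y z : E} {γ : ℝ → E} {a b : ℝ}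

theorem infDist_compl_pos (hΩ : IsOpen Ω) (hne : Ωᶜ.Nonempty) (hx : x ∈ Ω) :
    0 < infDist x Ωᶜ :=
  (hΩ.isClosed_compl.notMem_iff_infDist_pos hne).1 (not_not.2 hx)

theorem qhLength_nonneg (Ω : Set E) (γ : ℝ → E) (hab : a ≤ b) : 0 ≤ qhLength Ω γ a b :=
  intervalIntegral.integral_nonneg hab fun _ _ ↦ div_nonneg (norm_nonneg _) infDist_nonneg

theorem qhAdmissible.continuousOn (h : qhAdmissible Ω x y γ a b) : ContinuousOn γ (Icc a b) := by
  obtain ⟨-, -, -, -, K, hK⟩ := h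
  exact hK.continuousOn

theorem qhAdmissible.exists_infDist_ge (hΩ : IsOpen Ω) (hne : Ωᶜ.Nonempty)
    (h : qhAdmissible Ω x y γ a b) : ∃ c > 0, ∀ t ∈ Icc a b, c ≤ infDist (γ t) Ωᶜ := by
  have hc : ContinuousOn (fun t ↦ infDist (γ t) Ωᶜ) (Icc a b) :=
    (continuous_infDist_pt _).comp_continuousOn h.continuousOn
  obtain ⟨t₀, ht₀, hmin⟩ := isCompact_Icc.exists_isMinOn (nonempty_Icc.2 h.1) hc
  exact ⟨_, infDist_compl_pos hΩ hne (h.2.2.2.1 t₀ ht₀), fun t ht ↦ hmin ht⟩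

theorem qhAdmissible.intervalIntegrable (hΩ : IsOpen Ω) (hne : Ωᶜ.Nonempty)
    (h : qhAdmissible Ω x y γ a b) :
    IntervalIntegrable (fun t ↦ ‖deriv γ t‖ / infDist (γ t) Ωᶜ) volume a b := by
  have : CompleteSpace E := FiniteDimensional.complete ℝ E
  obtain ⟨c, hc, hcδ⟩ := h.exists_infDist_ge hΩ hne
  have hcont : ContinuousOn (fun t ↦ infDist (γ t) Ωᶜ) (Icc a b) :=
    (continuous_infDist_pt _).comp_continuousOn h.continuousOn
  obtain ⟨hab, -, -, -, K, hK⟩ := h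
  rw [intervalIntegrable_iff_integrableOn_Ioo_of_le hab]
  refine Integrable.of_bound ?_ (K / c) ?_
  · have h1 : AEStronglyMeasurable (fun t ↦ ‖deriv γ t‖) (volume.restrict (Ioo a b)) :=
      (stronglyMeasurable_deriv γ).norm.aestronglyMeasurable
    have h2 : AEStronglyMeasurable (fun t ↦ infDist (γ t) Ωᶜ) (volume.restrict (Ioo a b)) :=
      (hcont.mono Ioo_subset_Icc_self).aestronglyMeasurable measurableSet_Ioo
    exact (h1.aemeasurable.div h2.aemeasurable).aestronglyMeasurable
  · refine (ae_restrict_iff' measurableSet_Ioo).2 (ae_of_all _ fun t ht ↦ ?_)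
    have h1 : ‖deriv γ t‖ ≤ K := norm_deriv_le_of_lipschitzOn (Icc_mem_nhds ht.1 ht.2) hK
    have h2 := hcδ t (Ioo_subset_Icc_self ht)
    rw [Real.norm_of_nonneg (div_nonneg (norm_nonneg _) infDist_nonneg)]
    exact div_le_div₀ K.2 h1 hc h2

theorem qhAdmissible.mono {c d : ℝ} (h : qhAdmissible Ω x y γ a b) (hac : a ≤ c) (hcd : c ≤ d)
    (hdb : d ≤ b) : qhAdmissible Ω (γ c) (γ d) γ c d := by
  obtain ⟨-, -, -, hm, K, hK⟩ := h
  exact ⟨hcd, rfl, rfl, fun t ht ↦ hm t ⟨hac.trans ht.1, ht.2.trans hdb⟩, K,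
    hK.mono (Icc_subset_Icc hac hdb)⟩

theorem qhAdmissible.reverse (h : qhAdmissible Ω x y γ a b) :
    qhAdmissible Ω y x (fun t ↦ γ (-t)) (-b) (-a) := by
  obtain ⟨hab, hx, hy, hm, K, hK⟩ := h
  refine ⟨by linarith, by simpa, by simpa, fun t ht ↦ hm _ ⟨by linarith [ht.2], by linarith [ht.1]⟩,
    K, ?_⟩
  refine LipschitzOnWith.of_dist_le_mul fun s hs t ht ↦ ?_
  have := hK.dist_le_mul (-s) ⟨by linarith [hs.2], by linarith [hs.1]⟩ (-t)
    ⟨by linarith [ht.2], by linarith [ht.1]⟩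
  rwa [dist_neg_neg] at this

theorem qhLength_reverse (Ω : Set E) (γ : ℝ → E) (a b : ℝ) :
    qhLength Ω (fun t ↦ γ (-t)) (-b) (-a) = qhLength Ω γ a b := by
  unfold qhLength
  simp_rw [deriv_comp_neg, norm_neg]
  rw [intervalIntegral.integral_comp_neg (fun t ↦ ‖deriv γ t‖ / infDist (γ t) Ωᶜ)]
  simp

theorem qhAdmissible.shift (h : qhAdmissible Ω x y γ a b) (s : ℝ) :
    qhAdmissible Ω x y (fun t ↦ γ (t + s)) (a - s) (b - s) := by
  obtain ⟨hab, hx, hy, hm, K, hK⟩ := h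
  refine ⟨by linarith, by simpa, by simpa,
    fun t ht ↦ hm _ ⟨by linarith [ht.1], by linarith [ht.2]⟩, K, ?_⟩
  refine LipschitzOnWith.of_dist_le_mul fun u hu v hv ↦ ?_
  have := hK.dist_le_mul (u + s) ⟨by linarith [hu.1], by linarith [hu.2]⟩ (v + s)
    ⟨by linarith [hv.1], by linarith [hv.2]⟩
  rwa [dist_add_right] at this

theorem qhLength_shift (Ω : Set E) (γ : ℝ → E) (a b s : ℝ) :
    qhLength Ω (fun t ↦ γ (t + s)) (a - s) (b - s) = qhLength Ω γ a b := by
  unfold qhLength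
  simp_rw [deriv_comp_add_const]
  rw [intervalIntegral.integral_comp_add_right (fun t ↦ ‖deriv γ t‖ / infDist (γ t) Ωᶜ)]
  simp

theorem qhLength_congr {σ : ℝ → E} (hab : a ≤ b) (h : EqOn γ σ (Ioo a b)) :
    qhLength Ω γ a b = qhLength Ω σ a b := by
  unfold qhLength
  rw [intervalIntegral.integral_of_le hab, intervalIntegral.integral_of_le hab,
    integral_Ioc_eq_integral_Ioo, integral_Ioc_eq_integral_Ioo]
  refine setIntegral_congr_fun measurableSet_Ioo fun t ht ↦ ?_
  have h1 : γ =ᶠ[𝓝 t] σ := h.eventuallyEq_of_mem (Ioo_mem_nhds ht.1 ht.2)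
  simp only [h1.deriv_eq, h ht]

theorem qhAdmissible.exists_concat (hΩ : IsOpen Ω) (hne : Ωᶜ.Nonempty) {σ : ℝ → E} {c d : ℝ}
    (h : qhAdmissible Ω x y γ a b) (h' : qhAdmissible Ω y z σ c d) :
    ∃ ρ e, qhAdmissible Ω x z ρ a e ∧
      qhLength Ω ρ a e = qhLength Ω γ a b + qhLength Ω σ c d := by
  set τ : ℝ → E := fun t ↦ σ (t + (c - b)) with hτ
  have hτa : qhAdmissible Ω y z τ b (d - (c - b)) := by
    simpa using h'.shift (c - b)
  have hτl : qhLength Ω τ b (d - (c - b)) = qhLength Ω σ c d := by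
    simpa using qhLength_shift Ω σ c d (c - b)
  generalize d - (c - b) = e at hτa hτl
  set ρ : ℝ → E := fun t ↦ if t ≤ b then γ t else τ t with hρ
  have hρ1 : ∀ t ≤ b, ρ t = γ t := fun t ht ↦ if_pos ht
  have hρ2 : ∀ t, b ≤ t → ρ t = τ t := by
    intro t ht
    rcases ht.eq_or_lt with rfl | ht
    · rw [hρ1 _ le_rfl, h.2.2.1, hτa.2.1]
    · exact if_neg ht.not_ge
  obtain ⟨hab, hγa, hγb, hγm, K, hK⟩ := id h
  obtain ⟨hbe, hτb, hτe, hτm, K', hK'⟩ := id hτa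
  have hadm : qhAdmissible Ω x z ρ a e := by
    refine ⟨hab.trans hbe, by rw [hρ1 a hab, hγa], by rw [hρ2 e hbe, hτe], fun t ht ↦ ?_,
      max K K', LipschitzOnWith.of_dist_le_mul ?_⟩
    · rcases le_total t b with htb | htb
      · rw [hρ1 t htb]; exact hγm t ⟨ht.1, htb⟩
      · rw [hρ2 t htb]; exact hτm t ⟨htb, ht.2⟩
    · have key : ∀ s ∈ Icc a e, ∀ t ∈ Icc a e, s ≤ t →
          dist (ρ s) (ρ t) ≤ (max K K' : ℝ≥0) * dist s t := by
        intro s hs t ht hst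
        have hm1 : (K : ℝ) ≤ (max K K' : ℝ≥0) := by exact_mod_cast le_max_left K K'
        have hm2 : (K' : ℝ) ≤ (max K K' : ℝ≥0) := by exact_mod_cast le_max_right K K'
        have e1 : ∀ u ∈ Icc a b, ∀ v ∈ Icc a b,
            dist (ρ u) (ρ v) ≤ (max K K' : ℝ≥0) * dist u v := by
          intro u hu v hv
          rw [hρ1 u hu.2, hρ1 v hv.2]
          exact (hK.dist_le_mul u hu v hv).trans (by gcongr)
        have e2 : ∀ u ∈ Icc b e, ∀ v ∈ Icc b e,
            dist (ρ u) (ρ v) ≤ (max K K' : ℝ≥0) * dist u v := by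
          intro u hu v hv
          rw [hρ2 u hu.1, hρ2 v hv.1]
          exact (hK'.dist_le_mul u hu v hv).trans (by gcongr)
        rcases le_total t b with htb | htb
        · exact e1 s ⟨hs.1, hst.trans htb⟩ t ⟨ht.1, htb⟩
        rcases le_total s b with hsb | hsb
        · refine (dist_triangle _ (ρ b) _).trans
            ((add_le_add (e1 s ⟨hs.1, hsb⟩ b ⟨hab, le_rfl⟩)
              (e2 b ⟨le_rfl, hbe⟩ t ⟨htb, ht.2⟩)).trans (le_of_eq ?_))
          rw [← mul_add, Real.dist_eq, Real.dist_eq, Real.dist_eq, abs_of_nonpos (by linarith),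
            abs_of_nonpos (by linarith), abs_of_nonpos (by linarith)]
          ring
        · exact e2 s ⟨hsb, hst.trans ht.2⟩ t ⟨htb, ht.2⟩
      intro s hs t ht
      rcases le_total s t with hst | hst
      · exact key s hs t ht hst
      · rw [dist_comm, dist_comm s]; exact key t ht s hs hst
  refine ⟨ρ, e, hadm, ?_⟩
  have hsplit : qhLength Ω ρ a b + qhLength Ω ρ b e = qhLength Ω ρ a e :=
    intervalIntegral.integral_add_adjacent_intervals
      ((hadm.mono le_rfl hab hbe).intervalIntegrable hΩ hne)
      ((hadm.mono hab hbe le_rfl).intervalIntegrable hΩ hne)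
  rw [← hsplit, qhLength_congr hab fun t ht ↦ hρ1 t ht.2.le,
    qhLength_congr hbe fun t ht ↦ hρ2 t ht.1.le, hτl]

theorem bddBelow_qhLength (Ω : Set E) (x y : E) :
    BddBelow { L : ℝ | ∃ γ a b, qhAdmissible Ω x y γ a b ∧ L = qhLength Ω γ a b } := by
  refine ⟨0, ?_⟩
  rintro L ⟨γ, a, b, h, rfl⟩
  exact qhLength_nonneg Ω γ h.1

theorem qhDist_nonneg (Ω : Set E) (x y : E) : 0 ≤ qhDist Ω x y := by
  refine Real.sInf_nonneg ?_
  rintro L ⟨γ, a, b, h, rfl⟩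
  exact qhLength_nonneg Ω γ h.1

theorem qhAdmissible.qhDist_le (h : qhAdmissible Ω x y γ a b) :
    qhDist Ω x y ≤ qhLength Ω γ a b :=
  csInf_le (bddBelow_qhLength Ω x y) ⟨γ, a, b, h, rfl⟩

theorem qhDist_comm (Ω : Set E) (x y : E) : qhDist Ω x y = qhDist Ω y x := by
  unfold qhDist
  congr 1
  ext L
  constructor <;>
  · rintro ⟨γ, a, b, h, rfl⟩
    exact ⟨_, _, _, h.reverse, (qhLength_reverse Ω γ a b).symm⟩

theorem qhDist_self (hx : x ∈ Ω) : qhDist Ω x x = 0 := by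
  refine le_antisymm ?_ (qhDist_nonneg _ _ _)
  have h : qhAdmissible Ω x x (fun _ ↦ x) 0 0 :=
    ⟨le_rfl, rfl, rfl, fun _ _ ↦ hx, 0, LipschitzWith.const _ |>.lipschitzOnWith⟩
  refine h.qhDist_le.trans (le_of_eq ?_)
  simp [qhLength]

/-- The straight segment is admissible inside a ball contained in the domain, with controlled
quasihyperbolic length. -/
theorem exists_qhAdmissible_of_dist_lt
    (hy : dist y x < infDist x Ωᶜ / 2) :
    ∃ γ a b, qhAdmissible Ω x y γ a b ∧
      qhLength Ω γ a b ≤ dist y x * (2 / infDist x Ωᶜ) := by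
  set δ := infDist x Ωᶜ
  have hδ : 0 < δ := by linarith [dist_nonneg (x := y) (y := x)]
  have hd : ∀ t ∈ Icc (0 : ℝ) 1, δ / 2 ≤ infDist (AffineMap.lineMap x y t) Ωᶜ := by
    intro t ht
    have h1 : δ ≤ infDist (AffineMap.lineMap x y t) Ωᶜ + dist x (AffineMap.lineMap x y t) :=
      infDist_le_infDist_add_dist
    rw [dist_left_lineMap, dist_comm x y, Real.norm_of_nonneg ht.1] at h1
    nlinarith [ht.2, dist_nonneg (x := y) (y := x)]
  have hadm : qhAdmissible Ω x y (AffineMap.lineMap x y : ℝ → E) 0 1 := by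
    refine ⟨zero_le_one, by simp, by simp, fun t ht ↦ ?_, nndist x y, ?_⟩
    · by_contra hc
      have := infDist_zero_of_mem (s := Ωᶜ) hc
      linarith [hd t ht]
    · exact (lipschitzWith_lineMap x y).lipschitzOnWith
  refine ⟨_, _, _, hadm, ?_⟩
  unfold qhLength
  have hle : ∀ t ∈ Icc (0 : ℝ) 1, ‖deriv (AffineMap.lineMap x y : ℝ → E) t‖ /
      infDist (AffineMap.lineMap x y t) Ωᶜ ≤ dist y x * (2 / δ) := by
    intro t ht
    rw [AffineMap.hasDerivAt_lineMap.deriv, ← dist_eq_norm]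
    calc _ ≤ dist y x / (δ / 2) :=
          div_le_div_of_nonneg_left dist_nonneg (by linarith) (hd t ht)
      _ = _ := by field_simp
  have := intervalIntegral.norm_integral_le_of_norm_le_const (a := (0 : ℝ)) (b := 1)
    (f := fun t ↦ ‖deriv (AffineMap.lineMap x y : ℝ → E) t‖ /
      infDist (AffineMap.lineMap x y t) Ωᶜ) (C := dist y x * (2 / δ)) ?_
  · refine (le_abs_self _).trans ?_
    simpa using this
  · intro t ht
    rw [uIoc_of_le zero_le_one] at ht
    rw [Real.norm_of_nonneg (div_nonneg (norm_nonneg _) infDist_nonneg)]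
    exact hle t (Ioc_subset_Icc_self ht)

theorem exists_qhAdmissible (hΩ : IsOpen Ω) (hne : Ωᶜ.Nonempty) (hc : IsConnected Ω)
    (hx : x ∈ Ω) (hy : y ∈ Ω) : ∃ γ a b, qhAdmissible Ω x y γ a b := by
  refine hc.isPreconnected.induction₂ (fun x y ↦ ∃ γ a b, qhAdmissible Ω x y γ a b)
    ?_ ?_ ?_ hx hy
  · intro x hx
    have hδ := infDist_compl_pos hΩ hne hx
    filter_upwards [nhdsWithin_le_nhds (ball_mem_nhds x (half_pos hδ))] with y hy
    obtain ⟨γ, a, b, h, -⟩ := exists_qhAdmissible_of_dist_lt hy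
    exact ⟨γ, a, b, h⟩
  · rintro x y z - - - ⟨γ, a, b, h⟩ ⟨σ, c, d, h'⟩
    obtain ⟨ρ, e, hρ, -⟩ := h.exists_concat hΩ hne h'
    exact ⟨ρ, a, e, hρ⟩
  · rintro x y - - ⟨γ, a, b, h⟩
    exact ⟨_, _, _, h.reverse⟩

theorem exists_qhLength_lt (hΩ : IsOpen Ω) (hne : Ωᶜ.Nonempty) (hc : IsConnected Ω)
    (hx : x ∈ Ω) (hy : y ∈ Ω) {ε : ℝ} (hε : 0 < ε) :
    ∃ γ a b, qhAdmissible Ω x y γ a b ∧ qhLength Ω γ a b < qhDist Ω x y + ε := by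
  obtain ⟨γ, a, b, h⟩ := exists_qhAdmissible hΩ hne hc hx hy
  obtain ⟨L, ⟨γ, a, b, h, rfl⟩, hL⟩ := exists_lt_of_csInf_lt
    (s := { L : ℝ | ∃ γ a b, qhAdmissible Ω x y γ a b ∧ L = qhLength Ω γ a b })
    ⟨_, γ, a, b, h, rfl⟩ (lt_add_of_pos_right _ hε)
  exact ⟨γ, a, b, h, hL⟩

theorem qhDist_triangle (hΩ : IsOpen Ω) (hne : Ωᶜ.Nonempty) (hc : IsConnected Ω)
    (hx : x ∈ Ω) (hy : y ∈ Ω) (hz : z ∈ Ω) :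
    qhDist Ω x z ≤ qhDist Ω x y + qhDist Ω y z := by
  refine le_of_forall_pos_le_add fun ε hε ↦ ?_
  obtain ⟨γ, a, b, h, hl⟩ := exists_qhLength_lt hΩ hne hc hx hy (half_pos hε)
  obtain ⟨σ, c, d, h', hl'⟩ := exists_qhLength_lt hΩ hne hc hy hz (half_pos hε)
  obtain ⟨ρ, e, hρ, hl''⟩ := h.exists_concat hΩ hne h'
  linarith [hρ.qhDist_le]

theorem tendsto_qhDist_nhds (hΩ : IsOpen Ω) (hne : Ωᶜ.Nonempty) (hx : x ∈ Ω) :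
    Tendsto (fun y ↦ qhDist Ω x y) (𝓝 x) (𝓝 0) := by
  have hδ := infDist_compl_pos hΩ hne hx
  have h1 : Tendsto (fun y ↦ dist y x * (2 / infDist x Ωᶜ)) (𝓝 x) (𝓝 0) := by
    have : Continuous (fun y ↦ dist y x * (2 / infDist x Ωᶜ)) := by fun_prop
    simpa using this.tendsto x
  refine tendsto_of_tendsto_of_tendsto_of_le_of_le' tendsto_const_nhds h1
    (Eventually.of_forall fun y ↦ qhDist_nonneg _ _ _) ?_
  filter_upwards [ball_mem_nhds x (half_pos hδ)] with y hy
  obtain ⟨γ, a, b, h, hl⟩ := exists_qhAdmissible_of_dist_lt hy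
  exact h.qhDist_le.trans hl

/-- Joint continuity of the quasihyperbolic distance along filters. -/
theorem tendsto_qhDist (hΩ : IsOpen Ω) (hne : Ωᶜ.Nonempty) (hc : IsConnected Ω) {ι : Type*}
    {l : Filter ι} {u v : ι → E} (hx : x ∈ Ω) (hy : y ∈ Ω) (hu : Tendsto u l (𝓝 x))
    (hv : Tendsto v l (𝓝 y)) :
    Tendsto (fun i ↦ qhDist Ω (u i) (v i)) l (𝓝 (qhDist Ω x y)) := by
  have h1 := (tendsto_qhDist_nhds hΩ hne hx).comp hu
  have h2 := (tendsto_qhDist_nhds hΩ hne hy).comp hv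
  have h3 := h1.add h2
  rw [add_zero] at h3
  rw [tendsto_iff_dist_tendsto_zero]
  refine tendsto_of_tendsto_of_tendsto_of_le_of_le' tendsto_const_nhds h3
    (Eventually.of_forall fun _ ↦ dist_nonneg) ?_
  filter_upwards [hu (hΩ.mem_nhds hx), hv (hΩ.mem_nhds hy)] with i hi hj
  have t1 := qhDist_triangle hΩ hne hc hi hx hj
  have t2 := qhDist_triangle hΩ hne hc hx hy hj
  have t3 := qhDist_triangle hΩ hne hc hx hi hy
  have t4 := qhDist_triangle hΩ hne hc hi hj hy
  rw [qhDist_comm Ω (u i) x] at t1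
  rw [qhDist_comm Ω (v i) y] at t4
  rw [Real.dist_eq, abs_le]
  simp only [Function.comp]
  constructor <;> linarith

theorem norm_deriv_comp_le {w : E → ℝ} {C₀ t : ℝ} (hγ : DifferentiableAt ℝ γ t)
    (hw : ∀ C > C₀, ∀ᶠ q in 𝓝 (γ t), |w q - w (γ t)| ≤ C * dist q (γ t))
    (hd : DifferentiableAt ℝ (w ∘ γ) t) : ‖deriv (w ∘ γ) t‖ ≤ C₀ * ‖deriv γ t‖ := by
  have key : ∀ C > C₀, ‖deriv (w ∘ γ) t‖ ≤ C * ‖deriv γ t‖ := by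
    intro C hC
    have h1 := (hasDerivAt_iff_tendsto_slope.1 hd.hasDerivAt).norm
    have h2 := ((hasDerivAt_iff_tendsto_slope.1 hγ.hasDerivAt).norm).const_mul C
    refine le_of_tendsto_of_tendsto h1 h2 ?_
    have h3 := hγ.continuousAt.eventually (hw C hC)
    filter_upwards [nhdsWithin_le_nhds h3] with s hs
    rw [dist_eq_norm] at hs
    simp only [slope_def_module, norm_smul, Function.comp, Real.norm_eq_abs]
    calc _ ≤ |(s - t)⁻¹| * (C * ‖γ s - γ t‖) := by gcongr
      _ = _ := by ring
  have h4 : Tendsto (fun C : ℝ ↦ C * ‖deriv γ t‖) (𝓝[>] C₀) (𝓝 (C₀ * ‖deriv γ t‖)) :=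
    ((continuous_id.mul continuous_const).tendsto C₀).mono_left nhdsWithin_le_nhds
  exact ge_of_tendsto h4 (eventually_mem_nhdsWithin.mono key)

/-- Along an admissible path, a function whose pointwise Lipschitz constant is at most the
reciprocal of the distance to the boundary varies by at most the quasihyperbolic length. -/
theorem qhAdmissible.abs_sub_le_qhLength (hΩ : IsOpen Ω) (hne : Ωᶜ.Nonempty)
    (h : qhAdmissible Ω x y γ a b) {w : E → ℝ} {K' : ℝ≥0}
    (hw : ∀ p ∈ Ω, ∀ C > (infDist p Ωᶜ)⁻¹, ∀ᶠ q in 𝓝 p, |w q - w p| ≤ C * dist q p)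
    (hlip : LipschitzOnWith K' (w ∘ γ) (Icc a b)) : |w y - w x| ≤ qhLength Ω γ a b := by
  have hint := h.intervalIntegrable hΩ hne
  obtain ⟨hab, hx, hy, hm, K, hK⟩ := h
  rw [← hx, ← hy]
  have hac : AbsolutelyContinuousOnInterval (w ∘ γ) a b :=
    LipschitzOnWith.absolutelyContinuousOnInterval (by rwa [uIcc_of_le hab])
  have hftc := hac.integral_deriv_eq_sub
  simp only [Function.comp] at hftc
  rw [← hftc, ← Real.norm_eq_abs]
  refine intervalIntegral.norm_integral_le_of_norm_le hab ?_ hint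
  have hb : ∀ᵐ t : ℝ, t ≠ b := by simp [ae_iff, measure_singleton]
  filter_upwards [hK.ae_differentiableWithinAt_of_mem_real,
    hlip.ae_differentiableWithinAt_of_mem_real, hb] with t h1 h2 h3 ht
  have ht' : t ∈ Icc a b := Ioc_subset_Icc_self ht
  have hn : Icc a b ∈ 𝓝 t := Icc_mem_nhds ht.1 (lt_of_le_of_ne ht.2 h3)
  have := norm_deriv_comp_le ((h1 ht').differentiableAt hn) (hw _ (hm t ht'))
    ((h2 ht').differentiableAt hn)
  rw [div_eq_inv_mul]
  exact this

theorem exists_infDist_compl_le (hne : Ωᶜ.Nonempty) (hb : Bornology.IsBounded Ω) :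
    ∃ D > 0, ∀ p ∈ Ω, infDist p Ωᶜ ≤ D := by
  obtain ⟨c, hc⟩ := hne
  obtain ⟨D, hD, hsub⟩ := hb.subset_ball_lt 0 c
  exact ⟨D, hD, fun p hp ↦ (infDist_le_dist_of_mem hc).trans (mem_ball.1 (hsub hp)).le⟩

theorem exists_dist_le_mul_qhDist (hΩ : IsOpen Ω) (hne : Ωᶜ.Nonempty) (hc : IsConnected Ω)
    (hb : Bornology.IsBounded Ω) :
    ∃ D : ℝ≥0, ∀ x ∈ Ω, ∀ y ∈ Ω, dist x y ≤ D * qhDist Ω x y := by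
  obtain ⟨D, hD, hDle⟩ := exists_infDist_compl_le hne hb
  refine ⟨NNReal.mk D hD.le, fun x hx y hy ↦ ?_⟩
  rw [NNReal.coe_mk, ← div_le_iff₀' hD]
  obtain ⟨γ₀, a₀, b₀, h₀⟩ := exists_qhAdmissible hΩ hne hc hx hy
  refine le_csInf ⟨_, γ₀, a₀, b₀, h₀, rfl⟩ ?_
  rintro L ⟨γ, a, b, h, rfl⟩
  have hlipw : LipschitzWith (NNReal.mk D⁻¹ (inv_pos.2 hD).le) (fun q ↦ D⁻¹ * dist q x) := by
    refine LipschitzWith.of_dist_le_mul fun u v ↦ ?_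
    rw [Real.dist_eq, ← mul_sub, abs_mul, abs_of_pos (inv_pos.2 hD), NNReal.coe_mk]
    gcongr
    exact abs_dist_sub_le u v x
  obtain ⟨K, hK⟩ := h.2.2.2.2
  have := h.abs_sub_le_qhLength hΩ hne (w := fun q ↦ D⁻¹ * dist q x) ?_
    (hlipw.comp_lipschitzOnWith hK)
  · refine le_trans (le_of_eq ?_) ((le_abs_self _).trans this)
    rw [dist_self, dist_comm x y]
    ring
  · intro p hp C hC
    refine Eventually.of_forall fun q ↦ ?_
    have h1 := hlipw.dist_le_mul q p
    rw [NNReal.coe_mk, Real.dist_eq] at h1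
    refine h1.trans (mul_le_mul_of_nonneg_right ?_ dist_nonneg)
    exact (inv_anti₀ (infDist_compl_pos hΩ hne hp) (hDle p hp)).trans hC.le

theorem abs_log_infDist_sub_le (hΩ : IsOpen Ω) (hne : Ωᶜ.Nonempty) (hc : IsConnected Ω)
    (hx : x ∈ Ω) (hy : y ∈ Ω) :
    |Real.log (infDist y Ωᶜ) - Real.log (infDist x Ωᶜ)| ≤ qhDist Ω x y := by
  obtain ⟨γ₀, a₀, b₀, h₀⟩ := exists_qhAdmissible hΩ hne hc hx hy
  refine le_csInf ⟨_, γ₀, a₀, b₀, h₀, rfl⟩ ?_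
  rintro L ⟨γ, a, b, h, rfl⟩
  obtain ⟨c, hc, hcδ⟩ := h.exists_infDist_ge hΩ hne
  obtain ⟨K, hK⟩ := h.2.2.2.2
  have hlog : LipschitzOnWith (NNReal.mk c⁻¹ (inv_pos.2 hc).le) Real.log (Ici c) := by
    refine (convex_Ici c).lipschitzOnWith_of_nnnorm_deriv_le (𝕜 := ℝ) (fun s hs ↦ ?_)
      fun s hs ↦ ?_
    · exact Real.differentiableAt_log (hc.trans_le hs).ne'
    · rw [← NNReal.coe_le_coe, coe_nnnorm, Real.deriv_log, NNReal.coe_mk,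
        Real.norm_of_nonneg (inv_nonneg.2 (hc.le.trans hs))]
      exact inv_anti₀ hc hs
  refine h.abs_sub_le_qhLength hΩ hne (w := fun q ↦ Real.log (infDist q Ωᶜ)) ?_
    (hlog.comp ((lipschitz_infDist_pt Ωᶜ).comp_lipschitzOnWith hK) fun t ht ↦ hcδ t ht)
  intro p hp C hC
  have hδ := infDist_compl_pos hΩ hne hp
  have hC0 : 0 ≤ C := (inv_pos.2 hδ).le.trans hC.le
  have h1 : ∀ᶠ s in 𝓝 (infDist p Ωᶜ),
      ‖Real.log s - Real.log (infDist p Ωᶜ)‖ ≤ C * ‖s - infDist p Ωᶜ‖ := by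
    have hs := ((hasDerivAt_iff_tendsto_slope.1 (Real.hasDerivAt_log hδ.ne')).norm)
    rw [Real.norm_of_nonneg (inv_pos.2 hδ).le] at hs
    have hs' := eventually_nhdsWithin_iff.1 (hs.eventually_lt_const hC)
    filter_upwards [hs'] with s hs
    rcases eq_or_ne s (infDist p Ωᶜ) with rfl | hne'
    · simp
    · have := hs hne'
      rw [slope_def_field, norm_div, div_lt_iff₀ (norm_pos_iff.2 (sub_ne_zero.2 hne'))] at this
      exact this.le
  filter_upwards [(continuous_infDist_pt Ωᶜ).continuousAt.eventually h1] with q hq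
  refine hq.trans (mul_le_mul_of_nonneg_left ?_ hC0)
  have := (lipschitz_infDist_pt Ωᶜ).dist_le_mul q p
  simpa [Real.dist_eq] using this

/-- Points of a bounded domain at bounded quasihyperbolic distance lie in a compact subset. -/
theorem exists_isCompact_of_qhDist_le (hΩ : IsOpen Ω) (hne : Ωᶜ.Nonempty) (hc : IsConnected Ω)
    (hb : Bornology.IsBounded Ω) (hx : x ∈ Ω) (R : ℝ) :
    ∃ K, IsCompact K ∧ K ⊆ Ω ∧ ∀ y ∈ Ω, qhDist Ω x y ≤ R → y ∈ K := by
  have := FiniteDimensional.proper_real E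
  have hδ := infDist_compl_pos hΩ hne hx
  set c := Real.exp (Real.log (infDist x Ωᶜ) - R)
  have hc0 : 0 < c := Real.exp_pos _
  refine ⟨closure Ω ∩ {y | c ≤ infDist y Ωᶜ}, ?_, ?_, ?_⟩
  · exact hb.isCompact_closure.inter_right
      (isClosed_le continuous_const (continuous_infDist_pt _))
  · rintro y ⟨-, hy⟩
    by_contra hyc
    have := infDist_zero_of_mem (s := Ωᶜ) hyc
    exact absurd hy (by simp [this, hc0])
  · intro y hy hR
    refine ⟨subset_closure hy, ?_⟩
    have h1 := (abs_le.1 (abs_log_infDist_sub_le hΩ hne hc hx hy)).1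
    have h2 := infDist_compl_pos hΩ hne hy
    change Real.exp _ ≤ _
    rw [← Real.le_log_iff_exp_le h2]
    linarith

theorem exists_almost_qhGeodesic (hΩ : IsOpen Ω) (hne : Ωᶜ.Nonempty) (hc : IsConnected Ω)
    (hx : x ∈ Ω) (hy : y ∈ Ω) {ε : ℝ} (hε : 0 < ε) :
    ∃ g : ℝ → E, (∀ t ∈ Icc 0 (qhDist Ω x y), g t ∈ Ω) ∧
      qhDist Ω x (g 0) ≤ ε ∧ qhDist Ω (g (qhDist Ω x y)) y ≤ ε ∧
      ∀ s ∈ Icc 0 (qhDist Ω x y), ∀ t ∈ Icc 0 (qhDist Ω x y), s ≤ t →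
        |qhDist Ω (g s) (g t) - (t - s)| ≤ ε := by
  obtain ⟨γ, a, b, h, hl⟩ := exists_qhLength_lt hΩ hne hc hx hy hε
  have hle := h.qhDist_le
  set T := qhDist Ω x y with hT
  set F : ℝ → ℝ := fun t ↦ qhLength Ω γ a t with hF
  have hint := h.intervalIntegrable hΩ hne
  have hFc : ContinuousOn F (Icc a b) := by
    have := intervalIntegral.continuousOn_primitive_interval' hint left_mem_uIcc
    rwa [uIcc_of_le h.1] at this
  have hFa : F a = 0 := intervalIntegral.integral_same
  have hadd : ∀ s ∈ Icc a b, ∀ t ∈ Icc a b, s ≤ t → F s + qhLength Ω γ s t = F t := by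
    intro s hs t ht hst
    exact intervalIntegral.integral_add_adjacent_intervals
      ((h.mono le_rfl hs.1 hs.2).intervalIntegrable hΩ hne)
      ((h.mono hs.1 hst ht.2).intervalIntegrable hΩ hne)
  have hmono : MonotoneOn F (Icc a b) := by
    intro s hs t ht hst
    linarith [hadd s hs t ht hst, qhLength_nonneg Ω γ hst]
  have hex : ∀ s ∈ Icc 0 T, ∃ t ∈ Icc a b, F t = s := by
    intro s hs
    exact intermediate_value_Icc h.1 hFc ⟨by rw [hFa]; exact hs.1, hs.2.trans hle⟩
  choose! τ hτ hFτ using hex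
  have hT0 : 0 ≤ T := qhDist_nonneg _ _ _
  have hmem : ∀ t ∈ Icc 0 T, γ (τ t) ∈ Ω := fun t ht ↦ h.2.2.2.1 _ (hτ t ht)
  have hleft : ∀ t ∈ Icc 0 T, qhDist Ω x (γ (τ t)) ≤ t := by
    intro t ht
    have h1 := (h.mono le_rfl (hτ t ht).1 (hτ t ht).2).qhDist_le
    rw [h.2.1] at h1
    exact h1.trans (hFτ t ht).le
  have hright : ∀ t ∈ Icc 0 T, qhDist Ω (γ (τ t)) y ≤ T + ε - t := by
    intro t ht
    have h1 := (h.mono (hτ t ht).1 (hτ t ht).2 le_rfl).qhDist_le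
    rw [h.2.2.1] at h1
    have h2 := hadd _ (hτ t ht) b ⟨h.1, le_rfl⟩ (hτ t ht).2
    have h3 := hFτ t ht
    simp only [hF] at h2 h3
    linarith
  refine ⟨fun t ↦ γ (τ t), hmem, ?_, ?_, ?_⟩
  · exact (hleft 0 ⟨le_rfl, hT0⟩).trans hε.le
  · linarith [hright T ⟨hT0, le_rfl⟩]
  · intro s hs t ht hst
    have hup : qhDist Ω (γ (τ s)) (γ (τ t)) ≤ t - s := by
      rcases hst.eq_or_lt with rfl | hst
      · rw [qhDist_self (hmem s hs), sub_self]
      · have hττ : τ s ≤ τ t := by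
          by_contra hcon
          have := hmono (hτ t ht) (hτ s hs) (not_le.1 hcon).le
          rw [hFτ s hs, hFτ t ht] at this
          linarith
        have h1 := (h.mono (hτ s hs).1 hττ (hτ t ht).2).qhDist_le
        have h2 := hadd _ (hτ s hs) _ (hτ t ht) hττ
        rw [hFτ s hs, hFτ t ht] at h2
        linarith
    have t1 := qhDist_triangle hΩ hne hc hx (hmem s hs) hy
    have t2 := qhDist_triangle hΩ hne hc (hmem s hs) (hmem t ht) hy
    rw [abs_le]
    constructor <;> linarith [hleft s hs, hright t ht]

/-- Hopf–Rinow for the quasihyperbolic metric of a bounded domain. -/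
theorem exists_isQHGeodesicOn (hΩ : IsOpen Ω) (hne : Ωᶜ.Nonempty) (hc : IsConnected Ω)
    (hb : Bornology.IsBounded Ω) (hx : x ∈ Ω) (hy : y ∈ Ω) :
    ∃ g : ℝ → E, IsQHGeodesicOn Ω g (Icc 0 (qhDist Ω x y)) ∧ g 0 = x ∧
      g (qhDist Ω x y) = y := by
  set T := qhDist Ω x y with hT
  have hT0 : 0 ≤ T := qhDist_nonneg _ _ _
  have h0 : (0 : ℝ) ∈ Icc 0 T := ⟨le_rfl, hT0⟩
  have h1 : T ∈ Icc 0 T := ⟨hT0, le_rfl⟩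
  choose G hGm hG0 hG1 hG using fun k : ℕ ↦
    exists_almost_qhGeodesic hΩ hne hc hx hy (Nat.one_div_pos_of_nat (α := ℝ) (n := k))
  have hone : ∀ k : ℕ, (1 : ℝ) / (k + 1) ≤ 1 := fun k ↦ by
    rw [div_le_one (by positivity)]
    linarith [(Nat.cast_nonneg k : (0 : ℝ) ≤ k)]
  obtain ⟨K, hK, hKΩ, hKm⟩ := exists_isCompact_of_qhDist_le hΩ hne hc hb hx (T + 2)
  have hGK : ∀ t ∈ Icc 0 T, ∀ k, G k t ∈ K := by
    intro t ht k
    refine hKm _ (hGm k t ht) ?_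
    have t1 := qhDist_triangle hΩ hne hc hx (hGm k 0 h0) (hGm k t ht)
    have t2 := (abs_le.1 (hG k 0 h0 t ht ht.1)).2
    linarith [hG0 k, hone k, ht.2]
  set 𝓤 : Ultrafilter ℕ := Ultrafilter.of atTop
  have h𝓤 : (𝓤 : Filter ℕ) ≤ atTop := Ultrafilter.of_le atTop
  have hlim : ∀ t ∈ Icc 0 T, ∃ p ∈ K, Tendsto (fun k ↦ G k t) 𝓤 (𝓝 p) := by
    intro t ht
    exact hK.ultrafilter_le_nhds' (𝓤.map fun k ↦ G k t)
      (Ultrafilter.mem_map.2 (Eventually.of_forall (f := (𝓤 : Filter ℕ)) (hGK t ht)))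
  choose! g hgK hg using hlim
  have hz : Tendsto (fun k : ℕ ↦ (1 : ℝ) / (k + 1)) 𝓤 (𝓝 0) :=
    tendsto_one_div_add_atTop_nhds_zero_nat.mono_left h𝓤
  have hgΩ : ∀ t ∈ Icc 0 T, g t ∈ Ω := fun t ht ↦ hKΩ (hgK t ht)
  have hdist : ∀ s ∈ Icc 0 T, ∀ t ∈ Icc 0 T, s ≤ t → qhDist Ω (g s) (g t) = t - s := by
    intro s hs t ht hst
    have hl := tendsto_qhDist hΩ hne hc (hgΩ s hs) (hgΩ t ht) (hg s hs) (hg t ht)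
    have h2 := le_of_tendsto_of_tendsto' (hl.sub_const (t - s)).abs hz
      fun k ↦ hG k s hs t ht hst
    exact sub_eq_zero.1 (abs_nonpos_iff.1 h2)
  obtain ⟨D, hD⟩ := exists_dist_le_mul_qhDist hΩ hne hc hb
  have heq : ∀ u ∈ Ω, ∀ v ∈ Ω, qhDist Ω u v ≤ 0 → u = v := by
    intro u hu v hv huv
    refine dist_le_zero.1 ((hD u hu v hv).trans ?_)
    exact mul_nonpos_of_nonneg_of_nonpos D.2 huv
  refine ⟨g, ⟨hgΩ, fun s hs t ht ↦ ?_⟩, ?_, ?_⟩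
  · rcases le_total s t with hst | hst
    · rw [hdist s hs t ht hst, abs_of_nonpos (by linarith)]
      ring
    · rw [qhDist_comm, hdist t ht s hs hst, abs_of_nonneg (by linarith)]
  · refine (heq _ hx _ (hgΩ 0 h0) ?_).symm
    exact le_of_tendsto_of_tendsto'
      (tendsto_qhDist hΩ hne hc hx (hgΩ 0 h0) tendsto_const_nhds (hg 0 h0)) hz hG0
  · refine heq _ (hgΩ T h1) _ hy ?_
    exact le_of_tendsto_of_tendsto'
      (tendsto_qhDist hΩ hne hc (hgΩ T h1) hy (hg T h1) tendsto_const_nhds) hz hG1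

/-- In a visibility domain, Gromov products are bounded near pairs of distinct boundary points. -/
theorem QHVisibilityDomain.exists_gromovProduct_le (hv : QHVisibilityDomain Ω) (hΩ : IsOpen Ω)
    (hne : Ωᶜ.Nonempty) (hc : IsConnected Ω) (hb : Bornology.IsBounded Ω) {p q o : E}
    (hp : p ∈ frontier Ω) (hq : q ∈ frontier Ω) (hpq : p ≠ q) (ho : o ∈ Ω) :
    ∃ U ∈ 𝓝 p, ∃ V ∈ 𝓝 q, ∃ C : ℝ, ∀ u ∈ U ∩ Ω, ∀ v ∈ V ∩ Ω,
      qhDist Ω u o + qhDist Ω o v ≤ qhDist Ω u v + C := by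
  obtain ⟨U, V, hU, hV, hpU, hqV, -, K, hK, hKΩ, hvis⟩ := hv p hp q hq hpq
  have hcont : ContinuousOn (fun z ↦ qhDist Ω o z) K := fun z hz ↦
    tendsto_qhDist hΩ hne hc ho (hKΩ hz) tendsto_const_nhds
      (tendsto_id.mono_left nhdsWithin_le_nhds)
  obtain ⟨M, hM⟩ := hK.bddAbove_image hcont
  refine ⟨U, hU.mem_nhds hpU, V, hV.mem_nhds hqV, 2 * M, ?_⟩
  rintro u ⟨huU, hu⟩ v ⟨hvV, hv⟩
  obtain ⟨g, hg, hg0, hg1⟩ := exists_isQHGeodesicOn hΩ hne hc hb hu hv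
  have hT0 := qhDist_nonneg Ω u v
  set T := qhDist Ω u v
  obtain ⟨t, ht, htK⟩ := hvis g T hT0 hg (by rwa [hg0]) (by rwa [hg1])
  have hgt := hKΩ htK
  have d1 := hg.2 0 ⟨le_rfl, hT0⟩ t ht
  have d2 := hg.2 t ht T ⟨hT0, le_rfl⟩
  rw [hg0, abs_of_nonpos (by linarith [ht.1])] at d1
  rw [hg1, abs_of_nonpos (by linarith [ht.2])] at d2
  have t1 := qhDist_triangle hΩ hne hc hu hgt ho
  have t2 := qhDist_triangle hΩ hne hc ho hgt hv
  have hm : qhDist Ω o (g t) ≤ M := hM (mem_image_of_mem _ htK)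
  rw [qhDist_comm Ω (g t) o] at t1
  linarith

theorem mem_frontier_of_tendsto_of_tendsto_atTop (hΩ : IsOpen Ω) (hne : Ωᶜ.Nonempty)
    (hc : IsConnected Ω) {u : ℕ → E} {o : E} (ho : o ∈ Ω) (hu : ∀ k, u k ∈ Ω)
    (hx : Tendsto u atTop (𝓝 x)) (hd : Tendsto (fun k ↦ qhDist Ω o (u k)) atTop atTop) :
    x ∈ frontier Ω := by
  rw [hΩ.frontier_eq]
  refine ⟨mem_closure_of_tendsto hx (Eventually.of_forall hu), fun hxΩ ↦ ?_⟩
  exact not_tendsto_nhds_of_tendsto_atTop hd _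
    (tendsto_qhDist hΩ hne hc ho hxΩ tendsto_const_nhds hx)

theorem QHWellBehaved.tendsto_qhDist_of_mem (hw : QHWellBehaved Ω) {p o : E}
    (hp : p ∈ frontier Ω) (ho : o ∈ Ω) {x y : ℕ → E} {γ : ℕ → ℝ → E} {T t : ℕ → ℝ}
    (hx : ∀ k, x k ∈ Ω) (hy : ∀ k, y k ∈ Ω) (hxp : Tendsto x atTop (𝓝 p))
    (hyp : Tendsto y atTop (𝓝 p)) (hT : ∀ k, 0 ≤ T k)
    (hγ : ∀ k, IsQHGeodesicOn Ω (γ k) (Icc 0 (T k))) (h0 : ∀ k, γ k 0 = x k)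
    (h1 : ∀ k, γ k (T k) = y k) (ht : ∀ k, t k ∈ Icc 0 (T k)) :
    Tendsto (fun k ↦ qhDist Ω o (γ k (t k))) atTop atTop := by
  refine tendsto_atTop_mono (fun k ↦ ?_)
    (hw p hp x y γ (fun _ ↦ 0) T hx hy hxp hyp hT hγ h0 h1 o ho)
  refine csInf_le ⟨0, ?_⟩ (mem_image_of_mem _ (mem_image_of_mem _ (ht k)))
  rintro _ ⟨z, -, rfl⟩
  exact qhDist_nonneg _ _ _

variable {F : Type*} [NormedAddCommGroup F] [NormedSpace ℝ F] [FiniteDimensional ℝ F]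
  {Ω' : Set F}

/-- Two sequences converging to the same boundary point of a well behaved domain cannot have
images with different limits under a rough isometric embedding into a visibility domain. -/
theorem eq_of_tendsto_of_rough_isometry (hΩ : IsOpen Ω) (hne : Ωᶜ.Nonempty)
    (hc : IsConnected Ω) (hb : Bornology.IsBounded Ω) (hΩ' : IsOpen Ω') (hne' : Ω'ᶜ.Nonempty)
    (hc' : IsConnected Ω') (hb' : Bornology.IsBounded Ω') (hw : QHWellBehaved Ω)
    (hv : QHVisibilityDomain Ω') {f : E → F} {μ : ℝ} (hmaps : MapsTo f Ω Ω')
    (hcont : ContinuousOn f Ω)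
    (hqi : ∀ x ∈ Ω, ∀ y ∈ Ω,
      qhDist Ω x y - μ ≤ qhDist Ω' (f x) (f y) ∧ qhDist Ω' (f x) (f y) ≤ qhDist Ω x y + μ)
    {p : E} (hp : p ∈ frontier Ω) {x y : ℕ → E} (hx : ∀ k, x k ∈ Ω) (hy : ∀ k, y k ∈ Ω)
    (hxp : Tendsto x atTop (𝓝 p)) (hyp : Tendsto y atTop (𝓝 p)) {p' q' : F}
    (hfx : Tendsto (fun k ↦ f (x k)) atTop (𝓝 p'))
    (hfy : Tendsto (fun k ↦ f (y k)) atTop (𝓝 q')) : p' = q' := by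
  have := FiniteDimensional.proper_real F
  by_contra hne_pq
  obtain ⟨o, ho⟩ := hc.nonempty
  choose γ hγ hγ0 hγ1 using fun k ↦ exists_isQHGeodesicOn hΩ hne hc hb (hx k) (hy k)
  set T : ℕ → ℝ := fun k ↦ qhDist Ω (x k) (y k)
  have hT : ∀ k, 0 ≤ T k := fun k ↦ qhDist_nonneg _ _ _
  have hescape : ∀ t : ℕ → ℝ, (∀ k, t k ∈ Icc 0 (T k)) →
      Tendsto (fun k ↦ qhDist Ω' (f o) (f (γ k (t k)))) atTop atTop := by
    intro t ht
    refine tendsto_atTop_mono (fun k ↦ (hqi o ho _ ((hγ k).1 _ (ht k))).1) ?_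
    exact tendsto_atTop_add_const_right _ (-μ)
      (hw.tendsto_qhDist_of_mem hp ho hx hy hxp hyp hT hγ hγ0 hγ1 ht)
  have hp' : p' ∈ frontier Ω' := by
    refine mem_frontier_of_tendsto_of_tendsto_atTop hΩ' hne' hc' (hmaps ho)
      (fun k ↦ hmaps (hx k)) hfx ?_
    simpa only [hγ0] using hescape (fun _ ↦ 0) fun k ↦ ⟨le_rfl, hT k⟩
  have hq' : q' ∈ frontier Ω' := by
    refine mem_frontier_of_tendsto_of_tendsto_atTop hΩ' hne' hc' (hmaps ho)
      (fun k ↦ hmaps (hy k)) hfy ?_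
    simpa only [T, hγ1] using hescape T fun k ↦ ⟨hT k, le_rfl⟩
  obtain ⟨D, hD⟩ := exists_dist_le_mul_qhDist hΩ hne hc hb
  have hγc : ∀ k, ContinuousOn (fun t ↦ dist (f (γ k t)) p') (Icc 0 (T k)) := by
    intro k
    have hlip : LipschitzOnWith D (γ k) (Icc 0 (T k)) := by
      refine LipschitzOnWith.of_dist_le_mul fun s hs t ht ↦ ?_
      refine (hD _ ((hγ k).1 s hs) _ ((hγ k).1 t ht)).trans (le_of_eq ?_)
      rw [(hγ k).2 s hs t ht, Real.dist_eq]
    exact (continuous_id.dist continuous_const).comp_continuousOn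
      (hcont.comp hlip.continuousOn (hγ k).1)
  set r := dist p' q' / 2 with hr
  have hr0 : 0 < r := half_pos (dist_pos.2 hne_pq)
  have hpick : ∀ k, ∃ t ∈ Icc 0 (T k), dist (f (x k)) p' < r → r < dist (f (y k)) p' →
      dist (f (γ k t)) p' = r := by
    intro k
    by_cases h : dist (f (x k)) p' < r ∧ r < dist (f (y k)) p'
    · obtain ⟨t, ht, htr⟩ := intermediate_value_Icc (hT k) (hγc k)
        (show r ∈ Icc _ _ by
          simp only [T, hγ0, hγ1]
          exact ⟨h.1.le, h.2.le⟩)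
      exact ⟨t, ht, fun _ _ ↦ htr⟩
    · exact ⟨0, ⟨le_rfl, hT k⟩, fun h1 h2 ↦ absurd ⟨h1, h2⟩ h⟩
  choose t ht htr using hpick
  set w : ℕ → F := fun k ↦ f (γ k (t k))
  have hwΩ : ∀ k, w k ∈ Ω' := fun k ↦ hmaps ((hγ k).1 _ (ht k))
  have hw_esc : Tendsto (fun k ↦ qhDist Ω' (f o) (w k)) atTop atTop := hescape t ht
  have hwr : ∀ᶠ k in atTop, dist (w k) p' = r := by
    have h1 : Tendsto (fun k ↦ dist (f (x k)) p') atTop (𝓝 0) := by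
      simpa using hfx.dist (tendsto_const_nhds (x := p'))
    have h2 : Tendsto (fun k ↦ dist (f (y k)) p') atTop (𝓝 (dist q' p')) :=
      hfy.dist tendsto_const_nhds
    have h3 : r < dist q' p' := by
      rw [dist_comm q' p']
      linarith
    filter_upwards [h1.eventually_lt_const hr0, h2.eventually_const_lt h3] with k hk1 hk2
    exact htr k hk1 hk2
  obtain ⟨z, -, φ, hφ, hz⟩ := hb'.isCompact_closure.tendsto_subseq
    fun k ↦ subset_closure (hwΩ k)
  have hφt := hφ.tendsto_atTop
  have hzr : dist z p' = r :=
    tendsto_nhds_unique (hz.dist tendsto_const_nhds)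
      (tendsto_const_nhds.congr' ((hφt.eventually hwr).mono fun k hk ↦ hk.symm))
  have hzf : z ∈ frontier Ω' :=
    mem_frontier_of_tendsto_of_tendsto_atTop hΩ' hne' hc' (hmaps ho) (fun k ↦ hwΩ (φ k)) hz
      (hw_esc.comp hφt)
  have hpz : p' ≠ z := by
    rintro rfl
    rw [dist_self] at hzr
    linarith
  have hzq : z ≠ q' := by
    rintro rfl
    rw [dist_comm] at hzr
    linarith
  obtain ⟨U₁, hU₁, V₁, hV₁, C₁, hC₁⟩ :=
    hv.exists_gromovProduct_le hΩ' hne' hc' hb' hp' hzf hpz (hmaps ho)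
  obtain ⟨U₂, hU₂, V₂, hV₂, C₂, hC₂⟩ :=
    hv.exists_gromovProduct_le hΩ' hne' hc' hb' hzf hq' hzq (hmaps ho)
  have hlarge := (hw_esc.comp hφt).eventually_gt_atTop ((C₁ + C₂ + 3 * μ) / 2)
  obtain ⟨k, hk1, hk2, hk3, hk4, hk5⟩ := ((hfx.comp hφt).eventually hU₁ |>.and
    ((hz.eventually hV₁).and ((hz.eventually hU₂).and
      (((hfy.comp hφt).eventually hV₂).and hlarge)))).exists
  simp only [Function.comp] at hk1 hk2 hk3 hk4 hk5
  generalize φ k = j at hk1 hk2 hk3 hk4 hk5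
  have g1 := hC₁ _ ⟨hk1, hmaps (hx j)⟩ _ ⟨hk2, hwΩ j⟩
  have g2 := hC₂ _ ⟨hk3, hwΩ j⟩ _ ⟨hk4, hmaps (hy j)⟩
  have hγt := (hγ j).1 _ (ht j)
  have q1 := (hqi _ (hx j) _ hγt).2
  have q2 := (hqi _ hγt _ (hy j)).2
  have q3 := (hqi _ (hx j) _ (hy j)).1
  have d1 := (hγ j).2 0 ⟨le_rfl, hT j⟩ _ (ht j)
  have d2 := (hγ j).2 _ (ht j) (T j) ⟨hT j, le_rfl⟩
  rw [hγ0, abs_of_nonpos (by linarith [(ht j).1])] at d1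
  rw [show γ j (T j) = y j from hγ1 j, abs_of_nonpos (by linarith [(ht j).2])] at d2
  have tr := qhDist_triangle hΩ' hne' hc' (hmaps (hx j)) (hmaps ho) (hmaps (hy j))
  rw [qhDist_comm Ω' (w j) (f o)] at g2
  change qhDist Ω' (f (x j)) (w j) ≤ _ at q1
  change qhDist Ω' (w j) (f (y j)) ≤ _ at q2
  change T j - μ ≤ _ at q3
  linarith

end QuasihyperbolicMetric

/-- If `Ω ⊆ ℝⁿ` is a quasihyperbolically well behaved bounded domain and
`Ω' ⊆ ℝⁿ` is a bounded QH-visibility domain, then every continuous `(1, μ)`-quasi-isometric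
embedding `f : (Ω, k_Ω) → (Ω', k_Ω')` extends to a continuous map between the Euclidean
closures. -/
theorem statement14 {n : ℕ} (Ω Ω' : Set (EuclideanSpace ℝ (Fin n)))
    (hOpen : IsOpen Ω) (hConn : IsConnected Ω) (hBdd : Bornology.IsBounded Ω)
    (hOpen' : IsOpen Ω') (hConn' : IsConnected Ω') (hBdd' : Bornology.IsBounded Ω')
    (hWB : QHWellBehaved Ω) (hVis : QHVisibilityDomain Ω')
    (f : EuclideanSpace ℝ (Fin n) → EuclideanSpace ℝ (Fin n)) (μ : ℝ) (hμ : 0 ≤ μ)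
    (hmaps : MapsTo f Ω Ω') (hcont : ContinuousOn f Ω)
    (hqi : ∀ x ∈ Ω, ∀ y ∈ Ω,
      qhDist Ω x y - μ ≤ qhDist Ω' (f x) (f y) ∧ qhDist Ω' (f x) (f y) ≤ qhDist Ω x y + μ) :
    ∃ F : EuclideanSpace ℝ (Fin n) → EuclideanSpace ℝ (Fin n),
      ContinuousOn F (closure Ω) ∧ (∀ x ∈ Ω, F x = f x) ∧
      MapsTo F (closure Ω) (closure Ω') := by
  rcases eq_or_ne Ω' univ with rfl | hne'
  · have hsub : Subsingleton (EuclideanSpace ℝ (Fin n)) := by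
      by_contra h
      have := not_subsingleton_iff_nontrivial.1 h
      exact NormedSpace.noncompactSpace ℝ (EuclideanSpace ℝ (Fin n)) |>.noncompact_univ
        (by simpa using hBdd'.isCompact_closure)
    exact ⟨f, (subsingleton_of_subsingleton).continuousOn f, fun _ _ ↦ rfl,
      fun _ _ ↦ subset_closure (mem_univ _)⟩
  rcases eq_or_ne Ω univ with rfl | hne
  · exact ⟨f, by simpa using hcont, fun _ _ ↦ rfl, fun x _ ↦ subset_closure (hmaps (mem_univ x))⟩
  rw [← nonempty_compl] at hne hne'
  have hlim : ∀ p ∈ closure Ω, ∃ q ∈ closure Ω', Tendsto f (𝓝[Ω] p) (𝓝 q) := by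
    intro p hp
    by_cases hpΩ : p ∈ Ω
    · exact ⟨f p, subset_closure (hmaps hpΩ), hcont p hpΩ⟩
    have hpf : p ∈ frontier Ω := by
      rw [hOpen.frontier_eq]
      exact ⟨hp, hpΩ⟩
    have hK := hBdd'.isCompact_closure
    obtain ⟨x, hx, hxp⟩ := mem_closure_iff_seq_limit.1 hp
    obtain ⟨p', hp', φ, hφ, hfx⟩ := hK.tendsto_subseq fun k ↦ subset_closure (hmaps (hx k))
    refine ⟨p', hp', tendsto_of_subseq_tendsto fun y hy ↦ ?_⟩
    obtain ⟨hyp, hyΩ⟩ := tendsto_nhdsWithin_iff.1 hy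
    obtain ⟨N, hN⟩ := eventually_atTop.1 hyΩ
    have hyN : ∀ k, y (k + N) ∈ Ω := fun k ↦ hN _ (Nat.le_add_left N k)
    obtain ⟨q', -, ψ, hψ, hfy⟩ := hK.tendsto_subseq fun k ↦ subset_closure (hmaps (hyN k))
    have heq : p' = q' := eq_of_tendsto_of_rough_isometry hOpen hne hConn hBdd hOpen' hne'
      hConn' hBdd' hWB hVis hmaps hcont hqi hpf (fun k ↦ hx (φ k)) (fun k ↦ hyN (ψ k))
      (hxp.comp hφ.tendsto_atTop)
      (((tendsto_add_atTop_iff_nat N).2 hyp).comp hψ.tendsto_atTop) hfx hfy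
    exact ⟨fun k ↦ ψ k + N, heq ▸ hfy⟩
  refine ⟨extendFrom Ω f, continuousOn_extendFrom subset_rfl fun p hp ↦ ?_,
    extendFrom_extends hcont, fun p hp ↦ ?_⟩
  · obtain ⟨q, -, hq⟩ := hlim p hp
    exact ⟨q, hq⟩
  · obtain ⟨q, hqΩ, hq⟩ := hlim p hp
    rwa [extendFrom_eq hp hq]

end
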